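/- arXiv:2505.06550 — 4 statements merged into one kernel-verified Lean document; each statement's English description precedes it below -/
import Mathlib

section
/- For every finite simple graph G, the treewidth of G is at most 4 times the separation number of G, i.e. tw(G) ≤ 4·sep(G). -/
open SimpleGraph
open scoped ENNReal NNReal

/-- The set of vertices of `G` at graph-distance at most `r` from the set `S`. -/
def ballAround {V : Type*} (G : SimpleGraph V) (S : Set V) (r : ℕ) : Set V :=
  {v | ∃ u ∈ S, G.edist u v ≤ (r : ℕ∞)}

/-- A set `S` is `(k, r)`-centred in `G` if it is contained in the union of the balls of
radius `r` around at most `k` vertices. -/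
def IsCentred {V : Type*} (G : SimpleGraph V) (k r : ℕ) (S : Set V) : Prop :=
  ∃ T : Set V, T.ncard ≤ k ∧ S ⊆ ballAround G T r

/-- `S` is a balanced separator for the weight function `μ`: every connected component of
`G - S` carries at most half of the total weight. -/
def IsBalancedSeparator {V : Type*} (G : SimpleGraph V) (μ : V → NNReal) (S : Set V) : Prop :=
  ∀ C : (G.induce Sᶜ).ConnectedComponent,
    (∑ᶠ v ∈ C.supp, μ (v : V)) ≤ (∑ᶠ v : V, μ v) / 2

/-- `G` admits `(k, r)`-balanced separators: for every weight function there is a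
`(k, r)`-centred balanced separator. -/
def AdmitsBalancedSeparators {V : Type*} (G : SimpleGraph V) (k r : ℕ) : Prop :=
  ∀ μ : V → NNReal, ∃ S : Set V, IsCentred G k r S ∧ IsBalancedSeparator G μ S

/-- A tree-decomposition of `G` with nodes indexed by `τ`. -/
structure TreeDecomp {V : Type*} (G : SimpleGraph V) (τ : Type*) where
  tree : SimpleGraph τ
  isTree : tree.IsTree
  bag : τ → Set V
  covers_edge : ∀ ⦃u w : V⦄, G.Adj u w → ∃ x : τ, u ∈ bag x ∧ w ∈ bag x
  covers_vertex : ∀ v : V, ∃ x : τ, v ∈ bag x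
  bags_connected : ∀ v : V, (tree.induce {x : τ | v ∈ bag x}).Connected

/-- `G` has a tree-decomposition of width at most `w`. -/
def HasTreeDecompOfWidth {V : Type*} (G : SimpleGraph V) (w : ℕ) : Prop :=
  ∃ (τ : Type) (_ : Fintype τ) (D : TreeDecomp G τ), ∀ x : τ, (D.bag x).ncard ≤ w + 1

/-- The treewidth of `G`. -/
noncomputable def treewidth {V : Type*} (G : SimpleGraph V) : ℕ :=
  sInf {w : ℕ | HasTreeDecompOfWidth G w}

/-- The separation number of `G`. -/
noncomputable def sepNum {V : Type*} (G : SimpleGraph V) : ℕ :=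
  sInf {m : ℕ | ∀ μ : V → NNReal, ∃ S : Set V, S.ncard ≤ m ∧ IsBalancedSeparator G μ S}

/-- `φ` is a `q`-quasi-isometry from `G` to `H`. -/
def IsQuasiIsometry {V W : Type*} (q : ℕ) (G : SimpleGraph V) (H : SimpleGraph W)
    (φ : V → W) : Prop :=
  (∀ u v : V,
      (q : ℝ≥0∞)⁻¹ * (G.edist u v : ℝ≥0∞) - (q : ℝ≥0∞) ≤ (H.edist (φ u) (φ v) : ℝ≥0∞) ∧
      (H.edist (φ u) (φ v) : ℝ≥0∞) ≤ (q : ℝ≥0∞) * (G.edist u v : ℝ≥0∞) + (q : ℝ≥0∞)) ∧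
  ∀ x : W, ∃ v : V, H.edist x (φ v) ≤ (q : ℕ∞)

/-- The 2-subdivision of a graph `H`: each edge is replaced by a path of length 3.
The internal vertex `Sum.inr ⟨(a, b), _⟩` is the subdivision vertex on the edge `ab`
that is adjacent to `a`. -/
def twoSubdivision {V : Type*} (H : SimpleGraph V) :
    SimpleGraph (V ⊕ {p : V × V // H.Adj p.1 p.2}) :=
  SimpleGraph.fromRel fun a b =>
    match a, b with
    | Sum.inl x, Sum.inr p => x = p.1.1
    | Sum.inr p, Sum.inr q => p.1.1 = q.1.2 ∧ p.1.2 = q.1.1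
    | _, _ => False

/-- The largest size of an independent set of `G` contained in `Y`. -/
noncomputable def indepNumOn {V : Type*} (G : SimpleGraph V) (Y : Set V) : ℕ :=
  sSup {n : ℕ | ∃ s ⊆ Y, s.ncard = n ∧ s.Pairwise fun u v => ¬ G.Adj u v}

/-- `HasRootedDecomp G n X R` says that `G[X]` has a tree-decomposition with bags of size at
most `n` and a node whose bag contains `R`. -/
def HasRootedDecomp {V : Type*} (G : SimpleGraph V) (n : ℕ) (X R : Set V) : Prop :=
  ∃ (τ : Type) (_ : Fintype τ) (T : SimpleGraph τ) (β : τ → Set V) (r : τ),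
    T.IsTree ∧ R ⊆ β r ∧ (∀ x, β x ⊆ X) ∧ (∀ x, (β x).ncard ≤ n) ∧
    (∀ u ∈ X, ∀ w ∈ X, G.Adj u w → ∃ x, u ∈ β x ∧ w ∈ β x) ∧
    ∀ v ∈ X, (T.induce {x | v ∈ β x}).Connected

theorem SimpleGraph.Connected.induce_image {α β : Type*} {G : SimpleGraph α} {H : SimpleGraph β}
    (f : G →g H) {s : Set α} (h : (G.induce s).Connected) : (H.induce (f '' s)).Connected := by
  refine h.map (induceHom f (Set.mapsTo_image f s)) ?_
  rintro ⟨_, x, hx, rfl⟩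
  exact ⟨⟨x, hx⟩, rfl⟩

section Join

variable {α β : Type*} (T₁ : SimpleGraph α) (T₂ : SimpleGraph β) (r₁ : α) (r₂ : β)

/-- The disjoint union of two graphs together with an edge joining `r₁` to `r₂`. -/
def joinAt : SimpleGraph (α ⊕ β) :=
  (T₁ ⊕g T₂) ⊔ edge (Sum.inl r₁) (Sum.inr r₂)

/-- The inclusion of the first graph in the join. -/
def joinAtInl : T₁ →g joinAt T₁ T₂ r₁ r₂ :=
  (Hom.ofLE le_sup_left).comp (Embedding.sumInl (G := T₁) (H := T₂)).toHom

/-- The inclusion of the second graph in the join. -/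
def joinAtInr : T₂ →g joinAt T₁ T₂ r₁ r₂ :=
  (Hom.ofLE le_sup_left).comp (Embedding.sumInr (G := T₁) (H := T₂)).toHom

theorem joinAt_adj : (joinAt T₁ T₂ r₁ r₂).Adj (Sum.inl r₁) (Sum.inr r₂) := by
  simp [joinAt, edge_adj]

variable {T₁ T₂ r₁ r₂}

theorem connected_induce_joinAt_inl {s : Set α} (hs : (T₁.induce s).Connected) :
    ((joinAt T₁ T₂ r₁ r₂).induce (Sum.inl '' s)).Connected :=
  hs.induce_image (joinAtInl T₁ T₂ r₁ r₂)

theorem connected_induce_joinAt_inr {s : Set β} (hs : (T₂.induce s).Connected) :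
    ((joinAt T₁ T₂ r₁ r₂).induce (Sum.inr '' s)).Connected :=
  hs.induce_image (joinAtInr T₁ T₂ r₁ r₂)

theorem connected_induce_joinAt_union {s : Set α} {t : Set β} (hs : (T₁.induce s).Connected)
    (ht : (T₂.induce t).Connected) (h₁ : r₁ ∈ s) (h₂ : r₂ ∈ t) :
    ((joinAt T₁ T₂ r₁ r₂).induce (Sum.inl '' s ∪ Sum.inr '' t)).Connected :=
  connected_induce_union (connected_induce_joinAt_inl hs).preconnected
    (connected_induce_joinAt_inr ht).preconnected (Set.mem_image_of_mem _ h₁)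
    (Set.mem_image_of_mem _ h₂) (joinAt_adj T₁ T₂ r₁ r₂)

theorem exists_map_sumInl_eq_copy {x y : α ⊕ β} (p : (T₁ ⊕g T₂).Walk x y) {a b : α}
    (hx : x = (Embedding.sumInl (G := T₁) (H := T₂)).toHom a)
    (hy : y = (Embedding.sumInl (G := T₁) (H := T₂)).toHom b) :
    ∃ q : T₁.Walk a b, q.map (Embedding.sumInl (G := T₁) (H := T₂)).toHom = p.copy hx hy := by
  induction p generalizing a with
  | nil =>
    obtain rfl := Sum.inl_injective (hx.symm.trans hy)
    subst hx
    exact ⟨Walk.nil, rfl⟩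
  | @cons _ v _ h p ih =>
    subst hx hy
    rcases v with v | v
    · obtain ⟨q, hq⟩ := ih (a := v) rfl rfl
      refine ⟨Walk.cons (sum_adj_inl.1 h) q, ?_⟩
      rw [Walk.map_cons, hq]
      rfl
    · exact (Bool.false_ne_true h).elim

theorem not_isCycle_of_sumInl (h₁ : T₁.IsAcyclic) {a : α}
    (p : (T₁ ⊕g T₂).Walk (Sum.inl a) (Sum.inl a)) : ¬ p.IsCycle := by
  obtain ⟨q, hq⟩ := exists_map_sumInl_eq_copy p (a := a) (b := a) rfl rfl
  intro hp
  have hp' : (q.map (Embedding.sumInl (G := T₁) (H := T₂)).toHom).IsCycle := by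
    rw [hq]
    exact hp
  exact h₁ q ((Walk.isCycle_map_iff_of_injective Sum.inl_injective).1 hp')

theorem isAcyclic_sum (h₁ : T₁.IsAcyclic) (h₂ : T₂.IsAcyclic) : (T₁ ⊕g T₂).IsAcyclic := by
  rintro (a | b) p hp
  · exact not_isCycle_of_sumInl h₁ p hp
  · exact not_isCycle_of_sumInl h₂ (p.map (Iso.sumComm (G := T₁) (H := T₂)).toHom)
      (hp.map (f := (Iso.sumComm (G := T₁) (H := T₂)).toHom) (Equiv.sumComm α β).injective)

theorem isTree_joinAt (h₁ : T₁.IsTree) (h₂ : T₂.IsTree) : (joinAt T₁ T₂ r₁ r₂).IsTree := by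
  refine ⟨?_, (isAcyclic_sum h₁.isAcyclic h₂.isAcyclic).sup_edge_of_not_reachable
    (not_reachable_sum_inl_inr _ _)⟩
  have h := connected_induce_joinAt_union (r₁ := r₁) (r₂ := r₂)
    ((induceUnivIso T₁).connected_iff.2 h₁.connected)
    ((induceUnivIso T₂).connected_iff.2 h₂.connected) (Set.mem_univ _) (Set.mem_univ _)
  rw [Set.image_univ, Set.image_univ, Set.range_inl_union_range_inr] at h
  exact (induceUnivIso _).connected_iff.1 h

end Join

namespace HasRootedDecomp

variable {V : Type*} {G : SimpleGraph V} {n : ℕ} {X X₁ X₂ R R₁ R₂ : Set V}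

theorem mono_root (h : HasRootedDecomp G n X R) {R' : Set V} (hR : R' ⊆ R) :
    HasRootedDecomp G n X R' := by
  obtain ⟨τ, i, T, β, r, hT, hr, h⟩ := h
  exact ⟨τ, i, T, β, r, hT, hR.trans hr, h⟩

theorem self (hX : X.ncard ≤ n) : HasRootedDecomp G n X X := by
  refine ⟨Unit, inferInstance, ⊥, fun _ => X, (), IsTree.of_subsingleton, subset_rfl,
    fun _ => subset_rfl, fun _ => hX, fun u hu w hw _ => ⟨(), hu, hw⟩, fun v hv => ?_⟩
  have : Nonempty {x : Unit | v ∈ X} := ⟨⟨(), hv⟩⟩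
  exact ⟨Preconnected.of_subsingleton⟩

theorem union (h₁ : HasRootedDecomp G n X₁ R₁) (h₂ : HasRootedDecomp G n X₂ R₂)
    (hR₁ : X₁ ∩ X₂ ⊆ R₁) (hR₂ : X₁ ∩ X₂ ⊆ R₂)
    (hadj : ∀ u ∈ X₁ \ X₂, ∀ w ∈ X₂ \ X₁, ¬ G.Adj u w) :
    HasRootedDecomp G n (X₁ ∪ X₂) R₁ := by
  obtain ⟨τ₁, _, T₁, β₁, r₁, hT₁, hr₁, hX₁, hn₁, he₁, hc₁⟩ := h₁
  obtain ⟨τ₂, _, T₂, β₂, r₂, hT₂, hr₂, hX₂, hn₂, he₂, hc₂⟩ := h₂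
  refine ⟨τ₁ ⊕ τ₂, inferInstance, joinAt T₁ T₂ r₁ r₂, Sum.elim β₁ β₂, Sum.inl r₁,
    isTree_joinAt hT₁ hT₂, hr₁, ?_, ?_, ?_, ?_⟩
  · rintro (x | x)
    · exact (hX₁ x).trans Set.subset_union_left
    · exact (hX₂ x).trans Set.subset_union_right
  · rintro (x | x)
    · exact hn₁ x
    · exact hn₂ x
  · have key : ∀ u w, (u ∈ X₁ ∧ w ∈ X₁) ∨ (u ∈ X₂ ∧ w ∈ X₂) → G.Adj u w →
        ∃ x, u ∈ Sum.elim β₁ β₂ x ∧ w ∈ Sum.elim β₁ β₂ x := by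
      rintro u w (⟨hu, hw⟩ | ⟨hu, hw⟩) huw
      · obtain ⟨x, hx⟩ := he₁ u hu w hw huw
        exact ⟨Sum.inl x, hx⟩
      · obtain ⟨x, hx⟩ := he₂ u hu w hw huw
        exact ⟨Sum.inr x, hx⟩
    intro u hu w hw huw
    refine key u w ?_ huw
    by_contra hcon
    have h₁ := hadj u
    have h₂ := hadj w
    have := huw.symm
    simp only [Set.mem_union, Set.mem_sdiff] at *
    grind
  · intro v hv
    have hset : {x | v ∈ Sum.elim β₁ β₂ x} =
        Sum.inl '' {x | v ∈ β₁ x} ∪ Sum.inr '' {x | v ∈ β₂ x} := by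
      ext (x | x) <;> simp
    rw [hset]
    by_cases hv₁ : v ∈ X₁ <;> by_cases hv₂ : v ∈ X₂
    · exact connected_induce_joinAt_union (hc₁ v hv₁) (hc₂ v hv₂) (hr₁ (hR₁ ⟨hv₁, hv₂⟩))
        (hr₂ (hR₂ ⟨hv₁, hv₂⟩))
    · have : {x | v ∈ β₂ x} = ∅ := Set.eq_empty_of_forall_notMem fun x hx => hv₂ (hX₂ x hx)
      rw [this, Set.image_empty, Set.union_empty]
      exact connected_induce_joinAt_inl (hc₁ v hv₁)
    · have : {x | v ∈ β₁ x} = ∅ := Set.eq_empty_of_forall_notMem fun x hx => hv₁ (hX₁ x hx)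
      rw [this, Set.image_empty, Set.empty_union]
      exact connected_induce_joinAt_inr (hc₂ v hv₂)
    · exact absurd hv (by simp [hv₁, hv₂])

/-- Gluing decompositions of the sets `Y i` along a common bag `B`. -/
theorem biUnion {ι : Type*} {B : Set V} (hB : B.ncard ≤ n) (Y : ι → Set V) (s : Finset ι)
    (h : ∀ i ∈ s, HasRootedDecomp G n (Y i) (Y i ∩ B))
    (hdisj : ∀ i ∈ s, ∀ j ∈ s, i ≠ j → Y i ∩ Y j ⊆ B)
    (hadjB : ∀ i ∈ s, ∀ u ∈ Y i \ B, ∀ w ∈ B \ Y i, ¬ G.Adj u w)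
    (hadj : ∀ i ∈ s, ∀ j ∈ s, i ≠ j → ∀ u ∈ Y i \ B, ∀ w ∈ Y j \ B, ¬ G.Adj u w) :
    HasRootedDecomp G n (B ∪ ⋃ i ∈ s, Y i) B := by
  classical
  induction s using Finset.induction_on with
  | empty => simpa using self hB
  | insert a s ha ih =>
    have ih := ih (fun i hi => h i (Finset.mem_insert_of_mem hi))
      (fun i hi j hj => hdisj i (Finset.mem_insert_of_mem hi) j (Finset.mem_insert_of_mem hj))
      (fun i hi => hadjB i (Finset.mem_insert_of_mem hi))
      (fun i hi j hj => hadj i (Finset.mem_insert_of_mem hi) j (Finset.mem_insert_of_mem hj))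
    have hsub : (B ∪ ⋃ i ∈ s, Y i) ∩ Y a ⊆ B := by
      rintro v ⟨hv | hv, hva⟩
      · exact hv
      · obtain ⟨i, hi, hvi⟩ := Set.mem_iUnion₂.1 hv
        exact hdisj i (Finset.mem_insert_of_mem hi) a (Finset.mem_insert_self a s)
          (by rintro rfl; exact ha hi) ⟨hvi, hva⟩
    rw [Finset.set_biUnion_insert, Set.union_comm (Y a), ← Set.union_assoc]
    refine ih.union (h a (Finset.mem_insert_self a s)) hsub
      (fun v hv => ⟨hv.2, hsub hv⟩) ?_
    rintro u ⟨hu, hua⟩ w ⟨hwa, hw⟩ huw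
    have hwB : w ∉ B := fun hwB => hw (Or.inl hwB)
    by_cases huB : u ∈ B
    · exact hadjB a (Finset.mem_insert_self a s) w ⟨hwa, hwB⟩ u ⟨huB, hua⟩ huw.symm
    · obtain ⟨i, hi, hui⟩ := Set.mem_iUnion₂.1 (hu.resolve_left huB)
      exact hadj i (Finset.mem_insert_of_mem hi) a (Finset.mem_insert_self a s)
        (by rintro rfl; exact ha hi) u ⟨hui, huB⟩ w ⟨hwa, hwB⟩ huw

theorem hasTreeDecompOfWidth {w : ℕ} (h : HasRootedDecomp G (w + 1) Set.univ R) :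
    HasTreeDecompOfWidth G w := by
  obtain ⟨τ, hτ, T, β, r, hT, -, -, hn, he, hc⟩ := h
  refine ⟨τ, hτ, ⟨T, hT, β, fun u w huw => he u trivial w trivial huw, fun v => ?_,
    fun v => hc v trivial⟩, hn⟩
  obtain ⟨x⟩ := (hc v trivial).nonempty
  exact ⟨x, x.2⟩

end HasRootedDecomp

theorem exists_isBalancedSeparator_ncard_le_sepNum {V : Type*} [Finite V] (G : SimpleGraph V)
    (μ : V → NNReal) : ∃ S : Set V, S.ncard ≤ sepNum G ∧ IsBalancedSeparator G μ S := by
  have hne : {m : ℕ | ∀ μ : V → NNReal,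
      ∃ S : Set V, S.ncard ≤ m ∧ IsBalancedSeparator G μ S}.Nonempty := by
    refine ⟨Nat.card V, fun μ => ⟨Set.univ, (Set.ncard_univ V).le, fun C => ?_⟩⟩
    obtain ⟨v, -⟩ := C.nonempty_supp
    exact absurd (Set.mem_univ v.1) v.2
  exact Nat.sInf_mem hne μ

/-- A balanced separator for the indicator weight of `W` splits `W` evenly. -/
theorem IsBalancedSeparator.two_mul_ncard_inter_le {V : Type*} [Finite V] {G : SimpleGraph V}
    {S W : Set V} (h : IsBalancedSeparator G (W.indicator 1) S)
    (C : (G.induce Sᶜ).ConnectedComponent) :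
    2 * (W ∩ Subtype.val '' C.supp).ncard ≤ W.ncard := by
  have hcard : ∀ A : Set V,
      ∑ᶠ v ∈ A, W.indicator (1 : V → NNReal) v = ((W ∩ A).ncard : NNReal) := by
    intro A
    classical
    have := Fintype.ofFinite V
    have hWA : W ∩ A = (A.toFinset.filter (· ∈ W) : Finset V) := by
      ext
      simp [and_comm]
    rw [finsum_mem_eq_toFinset_sum, hWA, Set.ncard_coe_finset]
    simp [Set.indicator_apply]
  have hC := h C
  rw [← finsum_mem_image (f := W.indicator (1 : V → NNReal)) Subtype.val_injective.injOn, hcard,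
    ← finsum_mem_univ, hcard, Set.inter_univ, le_div_iff₀ two_pos] at hC
  rw [mul_comm]
  exact_mod_cast hC

theorem hasRootedDecomp_of_ncard_le {V : Type*} [Finite V] (G : SimpleGraph V) (X W : Set V)
    (hWX : W ⊆ X) (hW : W.ncard ≤ 3 * sepNum G + 1) :
    HasRootedDecomp G (4 * sepNum G + 1) X W := by
  induction hm : X.ncard using Nat.strong_induction_on generalizing X W with
  | _ m ih =>
  subst hm
  by_cases hX : X.ncard ≤ 4 * sepNum G + 1
  · exact (HasRootedDecomp.self hX).mono_root hWX
  obtain ⟨W', hWW', hW'X, hW'⟩ :=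
    Set.exists_subsuperset_card_eq hWX hW (show 3 * sepNum G + 1 ≤ X.ncard by omega)
  refine HasRootedDecomp.mono_root ?_ hWW'
  obtain ⟨S, hS, hbal⟩ := exists_isBalancedSeparator_ncard_le_sepNum G (W'.indicator 1)
  let K : (G.induce Sᶜ).ConnectedComponent → Set V := fun C => Subtype.val '' C.supp
  have hKS : ∀ C, ∀ v ∈ K C, v ∉ S := by
    rintro C _ ⟨v, -, rfl⟩
    exact v.2
  have hKadj : ∀ C, ∀ u ∈ K C, ∀ w, G.Adj u w → w ∉ S → w ∈ K C := by
    rintro C _ ⟨u, hu, rfl⟩ w huw hw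
    exact ⟨⟨w, hw⟩, C.mem_supp_of_adj_mem_supp hu huw, rfl⟩
  have hKeq : ∀ C C', ∀ v ∈ K C, v ∈ K C' → C = C' := by
    rintro C C' _ ⟨v, hv, rfl⟩ ⟨v', hv', hvv'⟩
    obtain rfl := Subtype.val_injective hvv'
    exact ConnectedComponent.eq_of_common_vertex hv hv'
  let B : Set V := W' ∪ S ∩ X
  have hSX : (S ∩ X).ncard ≤ sepNum G := (Set.ncard_le_ncard Set.inter_subset_left).trans hS
  have hB : B.ncard ≤ 4 * sepNum G + 1 := (Set.ncard_union_le _ _).trans (by omega)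
  let Y : (G.induce Sᶜ).ConnectedComponent → Set V := fun C => (K C ∪ S) ∩ X
  have := Fintype.ofFinite (G.induce Sᶜ).ConnectedComponent
  have hYB : ∀ C, ∀ v ∈ Y C, v ∉ B → v ∈ K C := fun C v hv hvB =>
    hv.1.resolve_right fun hvS => hvB (Or.inr ⟨hvS, hv.2⟩)
  have hcover : X = B ∪ ⋃ C ∈ Finset.univ, Y C := by
    refine Set.Subset.antisymm (fun v hv => ?_) ?_
    · by_cases hvS : v ∈ S
      · exact Or.inl (Or.inr ⟨hvS, hv⟩)
      · refine Or.inr (Set.mem_iUnion₂.2 ⟨connectedComponentMk _ ⟨v, hvS⟩, Finset.mem_univ _,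
          Or.inl ⟨⟨v, hvS⟩, rfl, rfl⟩, hv⟩)
    · exact Set.union_subset (Set.union_subset hW'X Set.inter_subset_right)
        (Set.iUnion₂_subset fun C _ => Set.inter_subset_right)
  have hmain : HasRootedDecomp G (4 * sepNum G + 1) (B ∪ ⋃ C ∈ Finset.univ, Y C) B := by
    refine HasRootedDecomp.biUnion hB Y Finset.univ (fun C _ => ?_) ?_ ?_ ?_
    · have hhalf : 2 * (W' ∩ K C).ncard ≤ W'.ncard := hbal.two_mul_ncard_inter_le C
      refine ih _ (Set.ncard_lt_ncard ⟨Set.inter_subset_right, fun hsub => ?_⟩) _ _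
        Set.inter_subset_left ?_ rfl
      · have hcov : W' ⊆ (W' ∩ K C) ∪ S := fun v hv =>
          (hsub (hW'X hv)).1.imp (fun h => ⟨hv, h⟩) id
        have := (Set.ncard_le_ncard hcov).trans (Set.ncard_union_le _ _)
        omega
      · have hcov : Y C ∩ B ⊆ (W' ∩ K C) ∪ S := by
          rintro v ⟨⟨hv | hv, -⟩, hvB⟩
          · exact hvB.imp (fun h => ⟨h, hv⟩) fun h => h.1
          · exact Or.inr hv
        have := (Set.ncard_le_ncard hcov).trans (Set.ncard_union_le _ _)
        omega
    · rintro C - C' - hne v ⟨⟨hv | hv, hvX⟩, hv' | hv', -⟩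
      · exact absurd (hKeq C C' v hv hv') hne
      all_goals exact Or.inr ⟨by assumption, hvX⟩
    · rintro C - u ⟨hu, huB⟩ w ⟨hwB, hw⟩ huw
      have hwX : w ∈ X := hcover.symm ▸ Or.inl hwB
      exact hw ⟨Or.inl (hKadj C u (hYB C u hu huB) w huw fun hwS => hw ⟨Or.inr hwS, hwX⟩), hwX⟩
    · rintro C - C' - hne u ⟨hu, huB⟩ w ⟨hw, hwB⟩ huw
      have hwC' := hYB C' w hw hwB
      exact hne (hKeq C C' w (hKadj C u (hYB C u hu huB) w huw (hKS C' w hwC')) hwC')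
  exact (hcover ▸ hmain).mono_root Set.subset_union_left

/-- Robertson–Seymour: the treewidth of a finite simple graph is at most four times
its separation number. -/
theorem treewidth_le_four_mul_sepNum {V : Type} [Fintype V] (G : SimpleGraph V) :
    treewidth G ≤ 4 * sepNum G := by
  exact Nat.sInf_le (hasRootedDecomp_of_ncard_le G Set.univ ∅ (Set.empty_subset _)
    (by simp)).hasTreeDecompOfWidth
end

section
/- For all k, q ∈ ℕ there exists r ∈ ℕ such that every finite simple graph that is q-quasi-isometric to a graph with treewidth at most k has a (k + 1, r)-centred tree-decomposition. -/
open SimpleGraph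
open scoped ENNReal NNReal

lemma SimpleGraph.exists_walk_length_le_of_edist_le {V : Type*} {G : SimpleGraph V} {u v : V}
    {n : ℕ} (h : G.edist u v ≤ (n : ℕ∞)) : ∃ p : G.Walk u v, p.length ≤ n := by
  obtain ⟨p, hp⟩ := SimpleGraph.exists_walk_of_edist_ne_top
    (ne_top_of_le_ne_top (ENat.natCast_ne_top n) h)
  exact ⟨p, by rw [← hp] at h; exact_mod_cast h⟩

lemma SimpleGraph.exists_edist_le_of_edist_le_add {V : Type*} {G : SimpleGraph V} {u v : V}
    {m n : ℕ} (h : G.edist u v ≤ ((m + n : ℕ) : ℕ∞)) :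
    ∃ w, G.edist u w ≤ (m : ℕ∞) ∧ G.edist w v ≤ (n : ℕ∞) := by
  obtain ⟨p, hp⟩ := exists_walk_length_le_of_edist_le h
  refine ⟨p.getVert m, (SimpleGraph.edist_le (p.take m)).trans ?_,
    (SimpleGraph.edist_le (p.drop m)).trans ?_⟩
  · rw [SimpleGraph.Walk.take_length]
    exact_mod_cast min_le_left _ _
  · rw [SimpleGraph.Walk.drop_length]
    exact_mod_cast Nat.sub_le_iff_le_add'.mpr hp

lemma treewidth_spec {V : Type*} [Finite V] (G : SimpleGraph V) :
    HasTreeDecompOfWidth G (treewidth G) := by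
  refine Nat.sInf_mem (s := {w | HasTreeDecompOfWidth G w})
    ⟨Nat.card V, Unit, inferInstance, ⟨⊥, .of_subsingleton, fun _ => Set.univ,
      fun _ _ _ => ⟨(), trivial, trivial⟩, fun _ => ⟨(), trivial⟩, fun v => ?_⟩, fun x => ?_⟩
  · have : Nonempty {x : Unit | v ∈ (Set.univ : Set V)} := ⟨⟨(), trivial⟩⟩
    exact ⟨.of_subsingleton⟩
  · simp [Set.ncard_univ]

namespace TreeDecomp

/-- The nodes whose bags meet a given ball form a connected subtree. -/
lemma connected_nodes_meeting_ball {W τ : Type*} {H : SimpleGraph W} (D : TreeDecomp H τ)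
    (c : W) (r : ℕ) :
    (D.tree.induce {x | ∃ w, H.edist w c ≤ (r : ℕ∞) ∧ w ∈ D.bag x}).Connected := by
  set S : Set τ := {x | ∃ w, H.edist w c ≤ (r : ℕ∞) ∧ w ∈ D.bag x}
  have key (w : W) (hw : H.edist w c ≤ (r : ℕ∞)) (x y : τ) (hx : w ∈ D.bag x)
      (hy : w ∈ D.bag y) :
      (D.tree.induce S).Reachable ⟨x, w, hw, hx⟩ ⟨y, w, hw, hy⟩ :=
    ((D.bags_connected w).preconnected ⟨x, hx⟩ ⟨y, hy⟩).map
      (SimpleGraph.induceHomOfLE D.tree (s := {z | w ∈ D.bag z}) (s' := S)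
        fun _ hz => ⟨w, hw, hz⟩).toHom
  obtain ⟨x₀, hx₀⟩ := D.covers_vertex c
  have hc : H.edist c c ≤ (r : ℕ∞) := by simp
  have toCentre : ∀ (w : W) (p : H.Walk w c), p.length ≤ r → ∀ (x : τ) (hx : x ∈ S),
      w ∈ D.bag x → (D.tree.induce S).Reachable ⟨x, hx⟩ ⟨x₀, c, hc, hx₀⟩ := by
    intro w p
    induction p with
    | nil => exact fun _ x _ hwx => key _ hc x x₀ hwx hx₀
    | cons h p ih =>
      intro hp x hx hwx
      obtain ⟨y, hy, hy'⟩ := D.covers_edge h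
      have hw := (SimpleGraph.edist_le (SimpleGraph.Walk.cons h p)).trans
        (by exact_mod_cast hp : _ ≤ (r : ℕ∞))
      rw [SimpleGraph.Walk.length_cons] at hp
      exact (key _ hw x y hwx hy).trans (ih key hx₀ hc (by omega) y _ hy')
  refine (SimpleGraph.connected_iff_exists_forall_reachable _).mpr ⟨⟨x₀, c, hc, hx₀⟩, ?_⟩
  rintro ⟨x, w, hw, hwx⟩
  obtain ⟨p, hp⟩ := SimpleGraph.exists_walk_length_le_of_edist_le hw
  exact (toCentre w p hp x _ hwx).symm

/-- Pull back a tree-decomposition along `φ`, where the bag of a node consists of all vertices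
whose image is within distance `r` of the original bag. -/
def comapBall {V W τ : Type*} {H : SimpleGraph W} (D : TreeDecomp H τ) (G : SimpleGraph V)
    (φ : V → W) (r : ℕ)
    (hφ : ∀ ⦃u v⦄, G.Adj u v → H.edist (φ u) (φ v) ≤ ((r + r : ℕ) : ℕ∞)) :
    TreeDecomp G τ where
  tree := D.tree
  isTree := D.isTree
  bag x := {v | ∃ w, H.edist w (φ v) ≤ (r : ℕ∞) ∧ w ∈ D.bag x}
  covers_edge u v huv := by
    obtain ⟨w, hu, hv⟩ := SimpleGraph.exists_edist_le_of_edist_le_add (hφ huv)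
    obtain ⟨x, hx⟩ := D.covers_vertex w
    exact ⟨x, ⟨w, by rwa [SimpleGraph.edist_comm], hx⟩, ⟨w, hv, hx⟩⟩
  covers_vertex v := by
    obtain ⟨x, hx⟩ := D.covers_vertex (φ v)
    exact ⟨x, φ v, by simp, hx⟩
  bags_connected v := D.connected_nodes_meeting_ball (φ v) r

end TreeDecomp

namespace IsQuasiIsometry

variable {V W : Type*} {q : ℕ} {G : SimpleGraph V} {H : SimpleGraph W} {φ : V → W}

lemma edist_map_le_of_adj (hφ : IsQuasiIsometry q G H φ) {u v : V} (huv : G.Adj u v) :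
    H.edist (φ u) (φ v) ≤ ((q + q : ℕ) : ℕ∞) := by
  have h := (hφ.1 u v).2
  rw [SimpleGraph.edist_eq_one_iff_adj.mpr huv] at h
  have h' : (H.edist (φ u) (φ v) : ℝ≥0∞) ≤ (((q + q : ℕ) : ℕ∞) : ℝ≥0∞) := by
    simpa using h
  exact_mod_cast h'

lemma edist_le_of_edist_map_le (hφ : IsQuasiIsometry q G H φ) {u v : V} {n : ℕ}
    (h : H.edist (φ u) (φ v) ≤ (n : ℕ∞)) :
    G.edist u v ≤ ((q * (n + q) : ℕ) : ℕ∞) := by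
  have hn : (H.edist (φ u) (φ v) : ℝ≥0∞) ≤ ((n : ℕ∞) : ℝ≥0∞) := by exact_mod_cast h
  have h₁ : (q : ℝ≥0∞)⁻¹ * (G.edist u v : ℝ≥0∞) ≤ ((n + q : ℕ) : ℝ≥0∞) := by
    simpa using tsub_le_iff_right.mp ((hφ.1 u v).1.trans hn)
  have h₂ : (G.edist u v : ℝ≥0∞) ≤ (((q * (n + q) : ℕ) : ℕ∞) : ℝ≥0∞) := by
    rw [mul_comm, ← div_eq_mul_inv,
      ENNReal.div_le_iff_le_mul (.inr (ENNReal.natCast_ne_top _))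
        (.inl (ENNReal.natCast_ne_top _))] at h₁
    · simpa [mul_comm] using h₁
  exact_mod_cast h₂

end IsQuasiIsometry

/-- Every finite graph `q`-quasi-isometric to a graph of treewidth at most `k` has a
`(k + 1, r)`-centred tree-decomposition, for some `r` depending only on `k` and `q`. -/
theorem centred_treeDecomp_of_quasiIsometric (k q : ℕ) :
    ∃ r : ℕ, ∀ (V : Type) (_ : Fintype V) (G : SimpleGraph V),
      (∃ (W : Type) (_ : Fintype W) (H : SimpleGraph W) (φ : V → W),
          treewidth H ≤ k ∧ IsQuasiIsometry q G H φ) →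
      ∃ (τ : Type) (_ : Fintype τ) (D : TreeDecomp G τ),
        ∀ x : τ, IsCentred G (k + 1) r (D.bag x) := by
  refine ⟨q * (q + q + q), ?_⟩
  rintro V _ G ⟨W, _, H, φ, htw, hφ⟩
  obtain ⟨τ, hτ, D, hD⟩ := treewidth_spec H
  refine ⟨τ, hτ, D.comapBall G φ q fun _ _ huv => hφ.edist_map_le_of_adj huv, fun x => ?_⟩
  choose ψ hψ using hφ.2
  refine ⟨ψ '' D.bag x, (Set.ncard_image_le (Set.toFinite _)).trans
    ((hD x).trans (Nat.add_le_add_right htw 1)), ?_⟩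
  rintro v ⟨w, hwv, hwx⟩
  refine ⟨ψ w, Set.mem_image_of_mem ψ hwx, hφ.edist_le_of_edist_map_le ?_⟩
  calc H.edist (φ (ψ w)) (φ v) ≤ H.edist (φ (ψ w)) w + H.edist w (φ v) :=
        SimpleGraph.edist_triangle
    _ ≤ q + q := add_le_add (by rw [SimpleGraph.edist_comm]; exact hψ w) hwv
    _ = ((q + q : ℕ) : ℕ∞) := by push_cast; rfl
end

section
/- Let C, γ, t ∈ ℕ with C ≥ 2 and γ ≥ 2, and let G be a finite simple graph containing neither K_γ^{(2)} nor K_{t,t} as an induced subgraph. Let Y ⊆ V(G) and define Z = {v ∈ V(G) : α(N[v] ∩ Y) ≥ α(Y)/C}, where N[v] is the closed neighbourhood of v in G. Then min{α(Y), α(Z)} ≤ (512C)^{γ^{2t}}. -/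
open SimpleGraph
open scoped ENNReal NNReal

open Finset in
/-- A relation whose in-degrees on `A` are all smaller than `D` has an independent set of size
`k` in `A` as soon as `A` has at least `2 * D * k` elements. -/
theorem exists_independent_of_inDegree_lt {α : Type*} (r : α → α → Prop) [DecidableRel r]
    {D : ℕ} (hD : 0 < D) (k : ℕ) (A : Finset α) (hdeg : ∀ i ∈ A, #(A.filter fun j => r j i) < D)
    (hA : 2 * D * k ≤ #A) :
    ∃ B ⊆ A, #B = k ∧ (B : Set α).Pairwise fun i j => ¬ r i j := by
  classical
  induction k generalizing A with
  | zero => exact ⟨∅, by simp, by simp, by simp⟩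
  | succ k ih =>
    have hApos : 0 < #A := lt_of_lt_of_le (by positivity) hA
    obtain ⟨i, hi, hout⟩ : ∃ i ∈ A, #(A.filter fun j => r i j) < D := by
      by_contra! hcon
      have h1 : ∑ i ∈ A, D ≤ ∑ i ∈ A, #(A.filter fun j => r i j) := sum_le_sum hcon
      have h2 : ∑ i ∈ A, #(A.filter fun j => r i j) = ∑ i ∈ A, #(A.filter fun j => r j i) :=
        sum_card_bipartiteAbove_eq_sum_card_bipartiteBelow r
      have h3 : ∑ i ∈ A, #(A.filter fun j => r j i) < ∑ i ∈ A, D :=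
        sum_lt_sum_of_nonempty (card_pos.mp hApos) hdeg
      omega
    have hcover : A ⊆ (A.filter fun j => j ≠ i ∧ ¬ r i j ∧ ¬ r j i) ∪
        ({i} ∪ ((A.filter fun j => r i j) ∪ (A.filter fun j => r j i))) := by
      intro j hj
      simp only [mem_union, mem_filter, mem_singleton]
      tauto
    have hcard := (card_le_card hcover).trans ((card_union_le _ _).trans
      (Nat.add_le_add_left ((card_union_le _ _).trans
        (Nat.add_le_add_left (card_union_le _ _) _)) _))
    have hin := hdeg i hi
    rw [card_singleton] at hcard
    obtain ⟨B, hBA, hBk, hB⟩ := ih (A.filter fun j => j ≠ i ∧ ¬ r i j ∧ ¬ r j i) (fun j hj =>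
      lt_of_le_of_lt (card_le_card (filter_subset_filter _ (filter_subset _ _)))
        (hdeg j (mem_filter.mp hj).1)) (by rw [Nat.mul_succ] at hA; omega)
    have hiB : i ∉ B := fun h => (mem_filter.mp (hBA h)).2.1 rfl
    refine ⟨insert i B, insert_subset hi (hBA.trans (filter_subset _ _)), ?_, ?_⟩
    · rw [card_insert_of_notMem hiB, hBk]
    · rw [coe_insert]
      exact hB.insert fun j hj _ => (mem_filter.mp (hBA hj)).2.2

open Finset in
/-- A Ramsey-type bound for symmetric relations. -/
theorem exists_pairwise_not_or_pairwise {α : Type*} (r : α → α → Prop)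
    (hr : ∀ i j, r i j → r j i) {k : ℕ} (hk : 0 < k) (l : ℕ) (A : Finset α)
    (hA : (2 * k) ^ l ≤ #A) :
    (∃ B ⊆ A, #B = k ∧ (B : Set α).Pairwise fun i j => ¬ r i j) ∨
      ∃ B ⊆ A, #B = l ∧ (B : Set α).Pairwise r := by
  classical
  induction l generalizing A with
  | zero => exact Or.inr ⟨∅, by simp, by simp, by simp⟩
  | succ l ih =>
    by_cases h : ∃ i ∈ A, (2 * k) ^ l ≤ #(A.filter fun j => j ≠ i ∧ r j i)
    · obtain ⟨i, hi, hcard⟩ := h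
      rcases ih _ hcard with ⟨B, hBA, hBk, hB⟩ | ⟨B, hBA, hBl, hB⟩
      · exact Or.inl ⟨B, hBA.trans (filter_subset _ _), hBk, hB⟩
      · have hiB : i ∉ B := fun h => (mem_filter.mp (hBA h)).2.1 rfl
        refine Or.inr ⟨insert i B, insert_subset hi (hBA.trans (filter_subset _ _)), ?_, ?_⟩
        · rw [card_insert_of_notMem hiB, hBl]
        · rw [coe_insert]
          exact hB.insert fun j hj _ =>
            ⟨hr _ _ (mem_filter.mp (hBA hj)).2.2, (mem_filter.mp (hBA hj)).2.2⟩
    · push Not at h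
      obtain ⟨B, hBA, hBk, hB⟩ := exists_independent_of_inDegree_lt
        (fun j i => j ≠ i ∧ r j i) (D := (2 * k) ^ l) (by positivity) k A h
        (by rw [pow_succ] at hA; linarith)
      exact Or.inl ⟨B, hBA, hBk, fun i hi j hj hij hr' => hB hi hj hij ⟨hij, hr'⟩⟩

/-- Two independent sets of size `t`, complete to each other, induce a `K_{t,t}`. -/
theorem nonempty_completeBipartiteGraph_embedding {V : Type*} (G : SimpleGraph V) {t : ℕ}
    {A X : Finset V} (hA : A.card = t) (hX : X.card = t)
    (hAi : ∀ u ∈ A, ∀ v ∈ A, ¬ G.Adj u v) (hXi : ∀ u ∈ X, ∀ v ∈ X, ¬ G.Adj u v)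
    (hAX : ∀ u ∈ A, ∀ v ∈ X, G.Adj u v) :
    Nonempty (completeBipartiteGraph (Fin t) (Fin t) ↪g G) := by
  let a := A.equivFinOfCardEq hA
  let x := X.equivFinOfCardEq hX
  refine ⟨⟨⟨Sum.elim (fun i => (a.symm i : V)) (fun i => (x.symm i : V)), ?_⟩, ?_⟩⟩
  · refine Function.Injective.sumElim ?_ ?_ ?_
    · exact Subtype.val_injective.comp a.symm.injective
    · exact Subtype.val_injective.comp x.symm.injective
    · exact fun i j => (hAX _ (a.symm i).2 _ (x.symm j).2).ne
  · rintro (i | i) (j | j)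
    · simpa using hAi _ (a.symm i).2 _ (a.symm j).2
    · simpa using hAX _ (a.symm i).2 _ (x.symm j).2
    · simpa using (hAX _ (a.symm j).2 _ (x.symm i).2).symm
    · simpa using hXi _ (x.symm i).2 _ (x.symm j).2

open Finset in
/-- A Kővári–Sós–Turán type statement: in a graph without induced `K_{t,t}`, fewer than `D`
vertices of an independent set `A` have at least `d` neighbours in an independent set `X`. -/
theorem card_filter_degree_lt {V : Type*} [DecidableEq V] (G : SimpleGraph V)
    [DecidableRel G.Adj] {t D d : ℕ}
    (hKtt : IsEmpty (completeBipartiteGraph (Fin t) (Fin t) ↪g G)) (ht : 0 < t) (hD : 0 < D)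
    {A X : Finset V} (hA : ∀ u ∈ A, ∀ v ∈ A, ¬ G.Adj u v) (hX : ∀ u ∈ X, ∀ v ∈ X, ¬ G.Adj u v)
    (hDd : 2 * t * #X ≤ D * d) (hd : 2 * t * D ^ t ≤ d) :
    #(A.filter fun a => d ≤ #(X.filter fun x => G.Adj a x)) < D := by
  by_contra! hcon
  obtain ⟨A', hA', hA'D⟩ := exists_subset_card_eq hcon
  have hA'A : A' ⊆ A := hA'.trans (filter_subset _ _)
  set H := X.filter fun x => t ≤ #(A'.filter fun a => G.Adj a x) with hH
  have h1 : D * d ≤ ∑ a ∈ A', #(X.filter fun x => G.Adj a x) := by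
    rw [← hA'D, ← smul_eq_mul]
    exact card_nsmul_le_sum _ _ _ fun a ha => (mem_filter.mp (hA' ha)).2
  have h2 : ∑ a ∈ A', #(X.filter fun x => G.Adj a x) =
      ∑ x ∈ X, #(A'.filter fun a => G.Adj a x) :=
    sum_card_bipartiteAbove_eq_sum_card_bipartiteBelow G.Adj
  have h3 : ∑ x ∈ X, #(A'.filter fun a => G.Adj a x) ≤
      ∑ x ∈ X, ((if t ≤ #(A'.filter fun a => G.Adj a x) then D else 0) + t) := by
    refine sum_le_sum fun x _ => ?_
    have := card_filter_le A' fun a => G.Adj a x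
    split_ifs <;> omega
  rw [sum_add_distrib, ← sum_filter, sum_const, sum_const, smul_eq_mul, smul_eq_mul, ← hH] at h3
  have h4 : d ≤ 2 * #H := by
    have : D * d ≤ D * (2 * #H) := by nlinarith
    exact Nat.le_of_mul_le_mul_left this hD
  have hsub : ∀ x ∈ H, ∃ B ⊆ A'.filter (fun a => G.Adj a x), #B = t := fun x hx =>
    exists_subset_card_eq (mem_filter.mp hx).2
  choose! f hfsub hfcard using hsub
  have hmaps : ∀ x ∈ H, f x ∈ powersetCard t A' := fun x hx =>
    mem_powersetCard.mpr ⟨(hfsub x hx).trans (filter_subset _ _), hfcard x hx⟩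
  have hlt : #(powersetCard t A') * (t - 1) < #H := by
    rw [card_powersetCard, hA'D]
    have hp : 0 < D ^ t := by positivity
    have h5 : D.choose t * (t - 1) ≤ D ^ t * (t - 1) :=
      Nat.mul_le_mul_right _ (Nat.choose_le_pow D t)
    obtain ⟨u, rfl⟩ : ∃ u, t = u + 1 := ⟨t - 1, by omega⟩
    simp only [Nat.add_sub_cancel] at h5 ⊢
    nlinarith
  obtain ⟨B, hB, hfib⟩ := exists_lt_card_fiber_of_mul_lt_card_of_maps_to hmaps hlt
  obtain ⟨X', hX', hX't⟩ := exists_subset_card_eq (show t ≤ #(H.filter (f · = B)) by omega)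
  rw [mem_powersetCard] at hB
  obtain ⟨φ⟩ := nonempty_completeBipartiteGraph_embedding G hB.2 hX't
    (fun u hu v hv => hA _ (hA'A (hB.1 hu)) _ (hA'A (hB.1 hv)))
    (fun u hu v hv => hX _ (mem_filter.mp (mem_filter.mp (hX' hu)).1).1 _
      (mem_filter.mp (mem_filter.mp (hX' hv)).1).1)
    (fun u hu v hv => by
      obtain ⟨hvH, hfv⟩ := mem_filter.mp (hX' hv)
      exact (mem_filter.mp (hfsub v hvH (hfv ▸ hu))).2)
  exact hKtt.false φ

/-- Vertices `v i` and `x i j` with the right adjacencies form an induced `K_γ^{(2)}`. -/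
theorem nonempty_twoSubdivision_top_embedding {V ι : Type*} (G : SimpleGraph V)
    (v : ι → V) (x : ι → ι → V) (hv : Function.Injective v) (hvv : ∀ i j, ¬ G.Adj (v i) (v j))
    (hvx : ∀ i j k, i ≠ j → (G.Adj (v k) (x i j) ↔ k = i))
    (hxx : ∀ i j k l, i ≠ j → k ≠ l → (G.Adj (x i j) (x k l) ↔ i = l ∧ j = k)) :
    Nonempty (twoSubdivision (⊤ : SimpleGraph ι) ↪g G) := by
  refine ⟨⟨⟨Sum.elim v (fun p => x p.1.1 p.1.2), ?_⟩, ?_⟩⟩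
  · refine Function.Injective.sumElim hv ?_ ?_
    · rintro ⟨⟨i, j⟩, hij⟩ ⟨⟨k, l⟩, hkl⟩ h
      have hij' : i ≠ j := hij
      have hkl' : k ≠ l := hkl
      have h1 : G.Adj (x i j) (x j i) := (hxx i j j i hij' hij'.symm).mpr ⟨rfl, rfl⟩
      have h' : x i j = x k l := h
      rw [h'] at h1
      obtain ⟨rfl, rfl⟩ := (hxx k l j i hkl' hij'.symm).mp h1
      rfl
    · rintro i ⟨⟨j, k⟩, hjk⟩ h
      have h1 : G.Adj (v j) (x j k) := (hvx j k j hjk).mpr rfl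
      have h' : v i = x j k := h
      rw [← h'] at h1
      exact hvv _ _ h1
  · rintro (i | ⟨⟨i, j⟩, hij⟩) (k | ⟨⟨k, l⟩, hkl⟩)
    · simpa [twoSubdivision] using hvv i k
    · simpa [twoSubdivision] using hvx k l i hkl
    · simpa [twoSubdivision, G.adj_comm] using hvx i j k hij
    · have hij' : i ≠ j := hij
      have hkl' : k ≠ l := hkl
      have := hxx i j k l hij' hkl'
      simp only [Function.Embedding.coeFn_mk, Sum.elim_inr, this, twoSubdivision,
        SimpleGraph.fromRel_adj, ne_eq, Sum.inr.injEq, Subtype.mk.injEq, Prod.mk.injEq]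
      constructor
      · rintro ⟨rfl, rfl⟩
        exact ⟨fun h => hij' h.1, Or.inl ⟨rfl, rfl⟩⟩
      · rintro ⟨-, ⟨h1, h2⟩ | ⟨h1, h2⟩⟩
        · exact ⟨h1, h2⟩
        · exact ⟨h2.symm, h1.symm⟩

open Finset in
/-- If sparse independent sets `T i` pairwise span an edge even after deleting up to `r` vertices
from each of them, then one edge can be chosen for each pair of indices from `P` so that the
chosen edges form an induced matching. -/
theorem exists_induced_matching {V ι : Type*} [Nonempty V] [DecidableEq V] [DecidableEq ι]
    (G : SimpleGraph V) [DecidableRel G.Adj] (T : ι → Finset V) {d r : ℕ}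
    (hT : ∀ i, ∀ u ∈ T i, ∀ w ∈ T i, ¬ G.Adj u w)
    (hd : ∀ i j, i ≠ j → ∀ u ∈ T i, #((T j).filter fun w => G.Adj u w) ≤ d)
    (hedge : ∀ i j, i ≠ j → ∀ A ⊆ T i, ∀ B ⊆ T j, #(T i \ A) ≤ r → #(T j \ B) ≤ r →
      ∃ a ∈ A, ∃ b ∈ B, G.Adj a b)
    (P : Finset (ι × ι)) (hP : ∀ p ∈ P, p.1 ≠ p.2) (hr : 2 * #P * d ≤ r) :
    ∃ a b : ι × ι → V, (∀ p ∈ P, a p ∈ T p.1 ∧ b p ∈ T p.2 ∧ G.Adj (a p) (b p)) ∧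
      ∀ p ∈ P, ∀ q ∈ P, p ≠ q → ¬ G.Adj (a p) (a q) ∧ ¬ G.Adj (a p) (b q) ∧
        ¬ G.Adj (b p) (a q) ∧ ¬ G.Adj (b p) (b q) := by
  induction P using Finset.induction_on with
  | empty =>
    exact ⟨fun _ => Classical.arbitrary V, fun _ => Classical.arbitrary V, by simp, by simp⟩
  | insert p P hpP ih =>
    rw [card_insert_of_notMem hpP] at hr
    obtain ⟨a, b, hab, hind⟩ := ih (fun q hq => hP q (mem_insert_of_mem hq)) (by nlinarith)
    have hloss : ∀ i,
        #(T i \ (T i).filter fun w => ∀ q ∈ P, ¬ G.Adj (a q) w ∧ ¬ G.Adj (b q) w) ≤ r := by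
      intro i
      have hle : ∀ j, ∀ u ∈ T j, #((T i).filter fun w => G.Adj u w) ≤ d := by
        intro j u hu
        by_cases hji : j = i
        · subst hji
          rw [filter_false_of_mem fun w hw => hT j u hu w hw]
          simp
        · exact hd j i hji u hu
      have hsub : (T i \ (T i).filter fun w => ∀ q ∈ P, ¬ G.Adj (a q) w ∧ ¬ G.Adj (b q) w) ⊆
          P.biUnion fun q => ((T i).filter fun w => G.Adj (a q) w) ∪
            (T i).filter fun w => G.Adj (b q) w := by
        intro w hw
        simp only [mem_sdiff, mem_filter, not_and, not_forall, mem_biUnion, mem_union] at hw ⊢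
        obtain ⟨hw, h⟩ := hw
        obtain ⟨q, hq, h⟩ := h hw
        exact ⟨q, hq, by tauto⟩
      refine (card_le_card hsub).trans ((card_biUnion_le_card_mul P _ (2 * d) fun q hq => ?_).trans
        (by nlinarith))
      refine (card_union_le _ _).trans ?_
      have h1 := hle _ _ (hab q hq).1
      have h2 := hle _ _ (hab q hq).2.1
      omega
    obtain ⟨a₀, ha₀, b₀, hb₀, hadj⟩ := hedge p.1 p.2 (hP p (mem_insert_self _ _)) _
      (filter_subset _ _) _ (filter_subset _ _) (hloss p.1) (hloss p.2)
    rw [mem_filter] at ha₀ hb₀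
    have hne : ∀ q ∈ P, q ≠ p := fun q hq h => hpP (h ▸ hq)
    refine ⟨Function.update a p a₀, Function.update b p b₀, ?_, ?_⟩
    · intro q hq
      rcases mem_insert.mp hq with rfl | hq
      · simpa using ⟨ha₀.1, hb₀.1, hadj⟩
      · simpa [hne q hq] using hab q hq
    · intro q hq q' hq' hqq
      rcases mem_insert.mp hq with rfl | hqP <;> rcases mem_insert.mp hq' with rfl | hqP'
      · exact (hqq rfl).elim
      · have h1 := ha₀.2 q' hqP'
        have h2 := hb₀.2 q' hqP'
        simp only [Function.update_self, Function.update_of_ne (hne q' hqP')]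
        exact ⟨fun h => h1.1 h.symm, fun h => h1.2 h.symm, fun h => h2.1 h.symm,
          fun h => h2.2 h.symm⟩
      · have h1 := ha₀.2 q hqP
        have h2 := hb₀.2 q hqP
        simp only [Function.update_self, Function.update_of_ne (hne q hqP)]
        exact ⟨h1.1, h2.1, h1.2, h2.2⟩
      · simpa only [Function.update_of_ne (hne q hqP), Function.update_of_ne (hne q' hqP')]
          using hind q hqP q' hqP' hqq

theorem card_le_indepNumOn {V : Type*} [Finite V] (G : SimpleGraph V) {Y : Set V} (s : Finset V)
    (hsY : ∀ u ∈ s, u ∈ Y) (hs : ∀ u ∈ s, ∀ v ∈ s, ¬ G.Adj u v) : s.card ≤ indepNumOn G Y := by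
  refine le_csSup ⟨Nat.card V, ?_⟩ ⟨s, hsY, Set.ncard_coe_finset s, fun u hu v hv _ => hs u hu v hv⟩
  rintro n ⟨t, -, rfl, -⟩
  exact Set.ncard_le_card t

theorem exists_independent_of_le_indepNumOn {V : Type*} [Finite V] (G : SimpleGraph V) {Y : Set V}
    {n : ℕ} (hn : n ≤ indepNumOn G Y) :
    ∃ s : Finset V, s.card = n ∧ (∀ u ∈ s, u ∈ Y) ∧ ∀ u ∈ s, ∀ v ∈ s, ¬ G.Adj u v := by
  classical
  have hmem : indepNumOn G Y ∈
      {n : ℕ | ∃ s ⊆ Y, s.ncard = n ∧ s.Pairwise fun u v => ¬ G.Adj u v} := by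
    refine Nat.sSup_mem ⟨0, ∅, by simp, by simp, by simp⟩ ⟨Nat.card V, ?_⟩
    rintro n ⟨t, -, rfl, -⟩
    exact Set.ncard_le_card t
  obtain ⟨s, hsY, hcard, hs⟩ := hmem
  have hfin := s.toFinite
  rw [Set.ncard_eq_toFinset_card s hfin] at hcard
  obtain ⟨t, hts, ht⟩ := Finset.exists_subset_card_eq (hcard ▸ hn)
  have hts' : ∀ u ∈ t, u ∈ s := fun u hu => hfin.mem_toFinset.mp (hts hu)
  refine ⟨t, ht, fun u hu => hsY (hts' u hu), fun u hu v hv h => ?_⟩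
  exact hs (hts' u hu) (hts' v hv) h.ne h

open Finset in
/-- Among `2 * C + 1` independent subsets of `Y` of size at least `α(Y) / C`, some two cannot be
made disjoint and anticomplete by deleting few vertices. -/
theorem exists_pair_not_separable {V : Type*} [Finite V] [DecidableEq V] (G : SimpleGraph V)
    {Y : Set V} {C s e : ℕ} (S : V → Finset V) (B : Finset V) (hB : #B = 2 * C + 1)
    (hSY : ∀ i ∈ B, ∀ u ∈ S i, u ∈ Y) (hSi : ∀ i ∈ B, ∀ u ∈ S i, ∀ w ∈ S i, ¬ G.Adj u w)
    (hSs : ∀ i ∈ B, #(S i) = s) (hs : 0 < s) (hY : indepNumOn G Y ≤ C * s) (he : 8 * C * e ≤ s) :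
    ∃ i ∈ B, ∃ j ∈ B, i ≠ j ∧ ∀ T ⊆ S i, ∀ T' ⊆ S j, #(S i \ T) ≤ e → #(S j \ T') ≤ e →
      Disjoint T T' → ∃ a ∈ T, ∃ b ∈ T', G.Adj a b := by
  by_contra! hcon
  replace hcon : ∀ i ∈ B, ∀ j ∈ B, i ≠ j → ∃ T T', T ⊆ S i ∧ T' ⊆ S j ∧ #(S i \ T) ≤ e ∧
      #(S j \ T') ≤ e ∧ Disjoint T T' ∧ ∀ a ∈ T, ∀ b ∈ T', ¬ G.Adj a b := by
    intro i hi j hj hij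
    obtain ⟨T, hT, T', hT', h⟩ := hcon i hi j hj hij
    exact ⟨T, T', hT, hT', h⟩
  choose! T T' hTS hTS' hTe hTe' hdisj hanti using hcon
  classical
  set U : V → Finset V := fun i => (S i).filter fun x => ∀ j ∈ B, j ≠ i → x ∈ T i j ∧ x ∈ T' j i
    with hU
  have hloss : ∀ i ∈ B, s ≤ #(U i) + 4 * C * e := by
    intro i hi
    have hsub : S i ⊆ U i ∪ (B.erase i).biUnion fun j => (S i \ T i j) ∪ (S i \ T' j i) := by
      intro x hx
      simp only [hU, mem_union, mem_filter, mem_biUnion, mem_erase, mem_sdiff]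
      by_contra! h
      obtain ⟨j, hj, hji, h'⟩ := h.1 hx
      have := h.2 j ⟨hji, hj⟩
      exact h' (by tauto) (by tauto)
    have h1 := card_biUnion_le_card_mul (B.erase i)
      (fun j => (S i \ T i j) ∪ (S i \ T' j i)) (2 * e) fun j hj => by
        obtain ⟨hji, hj⟩ := mem_erase.mp hj
        have h1 := hTe i hi j hj hji.symm
        have h2 := hTe' j hj i hi hji
        have := card_union_le (S i \ T i j) (S i \ T' j i)
        omega
    rw [card_erase_of_mem hi, hB] at h1
    have h2 := (card_le_card hsub).trans (card_union_le _ _)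
    rw [hSs i hi] at h2
    simp only [Nat.add_sub_cancel] at h1
    nlinarith
  have hUB : ∀ i ∈ B, ∀ j ∈ B, i ≠ j → ∀ x ∈ U i, ∀ y ∈ U j, x ∈ T i j ∧ y ∈ T' i j :=
    fun i hi j hj hij x hx y hy =>
      ⟨((mem_filter.mp hx).2 j hj hij.symm).1, ((mem_filter.mp hy).2 i hi hij).2⟩
  have hcard : #(B.biUnion U) = ∑ i ∈ B, #(U i) := by
    refine card_biUnion fun i hi j hj hij => disjoint_left.mpr fun x hx hx' => ?_
    obtain ⟨h1, h2⟩ := hUB i hi j hj hij x hx x hx'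
    exact disjoint_left.mp (hdisj i hi j hj hij) h1 h2
  have hle : #(B.biUnion U) ≤ indepNumOn G Y := by
    refine card_le_indepNumOn G _ ?_ ?_
    · intro u hu
      obtain ⟨i, hi, hu⟩ := mem_biUnion.mp hu
      exact hSY i hi u (mem_filter.mp hu).1
    · intro u hu w hw
      obtain ⟨i, hi, hu⟩ := mem_biUnion.mp hu
      obtain ⟨j, hj, hw⟩ := mem_biUnion.mp hw
      by_cases hij : i = j
      · subst hij
        exact hSi i hi u (mem_filter.mp hu).1 w (mem_filter.mp hw).1
      · obtain ⟨h1, h2⟩ := hUB i hi j hj hij u hu w hw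
        exact hanti i hi j hj hij u h1 w h2
  have hsum : #B * s ≤ ∑ i ∈ B, (2 * #(U i)) := by
    rw [← smul_eq_mul]
    refine card_nsmul_le_sum _ _ _ fun i hi => ?_
    have := hloss i hi
    nlinarith
  rw [← mul_sum, ← hcard, hB] at hsum
  nlinarith

open Finset in
/-- The core of the argument: a large independent set `I`, each of whose vertices `v` is complete
to an independent set `S v ⊆ Y` of size `s ≥ α(Y) / C`, forces an induced `K_{t,t}` or an
induced `K_γ^{(2)}`. -/
theorem nonempty_twoSubdivision_embedding_of_large {V : Type*} [Finite V] (G : SimpleGraph V)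
    {C γ t s d D : ℕ} (hγ : 0 < γ) (ht : 0 < t) (hD : 0 < D)
    (hKtt : IsEmpty (completeBipartiteGraph (Fin t) (Fin t) ↪g G)) {Y : Set V}
    (S : V → Finset V) (I : Finset V) (hI : ∀ u ∈ I, ∀ w ∈ I, ¬ G.Adj u w)
    (hSY : ∀ i ∈ I, ∀ u ∈ S i, u ∈ Y) (hSi : ∀ i ∈ I, ∀ u ∈ S i, ∀ w ∈ S i, ¬ G.Adj u w)
    (hSs : ∀ i ∈ I, #(S i) = s) (hSadj : ∀ i ∈ I, ∀ u ∈ S i, G.Adj i u)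
    (hs : 0 < s) (hY : indepNumOn G Y ≤ C * s) (hDd : 2 * t * s ≤ D * d)
    (hd : 2 * t * D ^ t ≤ d) (hds : 32 * C * γ ^ 2 * d ≤ s)
    (hIcard : 2 * D * (2 * (2 * C + 1)) ^ γ ≤ #I) :
    Nonempty (twoSubdivision (⊤ : SimpleGraph (Fin γ)) ↪g G) := by
  classical
  have hDled : D ≤ d := by
    have h1 : D ^ 1 ≤ D ^ t := Nat.pow_le_pow_right hD ht
    nlinarith
  obtain ⟨I', hI'I, hI'card, hsparse⟩ := exists_independent_of_inDegree_lt
    (fun j i => d ≤ #((S i).filter fun x => G.Adj j x)) hD _ I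
    (fun i hi => card_filter_degree_lt G hKtt ht hD hI (hSi i hi) (by rwa [hSs i hi]) hd) hIcard
  let good : V → V → Prop := fun i j => ∀ T ⊆ S i, ∀ T' ⊆ S j, #(S i \ T) ≤ 4 * γ ^ 2 * d →
    #(S j \ T') ≤ 4 * γ ^ 2 * d → Disjoint T T' → ∃ a ∈ T, ∃ b ∈ T', G.Adj a b
  have hgood_symm : ∀ i j, good i j → good j i := by
    intro i j h T hT T' hT' hc hc' hdisj
    obtain ⟨a, ha, b, hb, hab⟩ := h T' hT' T hT hc' hc hdisj.symm
    exact ⟨b, hb, a, ha, hab.symm⟩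
  rcases exists_pairwise_not_or_pairwise good hgood_symm (k := 2 * C + 1) (by omega) γ I'
    hI'card.ge with ⟨B, hBI, hBcard, hB⟩ | ⟨B, hBI, hBcard, hB⟩
  · have hBI' : ∀ i ∈ B, i ∈ I := fun i hi => hI'I (hBI hi)
    obtain ⟨i, hi, j, hj, hij, h⟩ := exists_pair_not_separable G (e := 4 * γ ^ 2 * d) S B hBcard
      (fun i hi => hSY i (hBI' i hi)) (fun i hi => hSi i (hBI' i hi))
      (fun i hi => hSs i (hBI' i hi)) hs hY (by nlinarith)
    exact (hB hi hj hij h).elim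
  let f := B.equivFinOfCardEq hBcard
  let v : Fin γ → V := fun i => f.symm i
  have hv : Function.Injective v := Subtype.val_injective.comp f.symm.injective
  have hvB : ∀ i, v i ∈ B := fun i => (f.symm i).2
  have hvI : ∀ i, v i ∈ I := fun i => hI'I (hBI (hvB i))
  have hvd : ∀ i j, i ≠ j → #((S (v i)).filter fun x => G.Adj (v j) x) ≤ d := fun i j hij =>
    (not_le.mp (hsparse (hBI (hvB j)) (hBI (hvB i)) (hv.ne hij.symm))).le
  let T : Fin γ → Finset V := fun i => (S (v i)).filter fun x => ∀ j, j ≠ i →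
    ¬ G.Adj (v j) x ∧ #((S (v j)).filter fun y => G.Adj x y) < d
  have hTS : ∀ i, T i ⊆ S (v i) := fun i => filter_subset _ _
  have hTi : ∀ i, ∀ u ∈ T i, ∀ w ∈ T i, ¬ G.Adj u w := fun i u hu w hw =>
    hSi _ (hvI i) u (hTS i hu) w (hTS i hw)
  have hTv : ∀ i k, ∀ u ∈ T i, G.Adj (v k) u ↔ k = i := by
    intro i k u hu
    refine ⟨fun h => ?_, ?_⟩
    · by_contra hki
      exact ((mem_filter.mp hu).2 k hki).1 h
    · rintro rfl
      exact hSadj _ (hvI k) u (hTS k hu)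
  have hTloss : ∀ i, #(S (v i) \ T i) ≤ γ * (2 * d) := by
    intro i
    have hsub : S (v i) \ T i ⊆ (univ.erase i).biUnion fun j =>
        ((S (v i)).filter fun x => G.Adj (v j) x) ∪
          (S (v i)).filter fun x => d ≤ #((S (v j)).filter fun y => G.Adj x y) := by
      intro x hx
      simp only [T, mem_sdiff, mem_filter, not_and, not_forall, mem_biUnion, mem_erase, mem_univ,
        mem_union, not_lt] at hx ⊢
      obtain ⟨hx, h⟩ := hx
      obtain ⟨j, hji, h⟩ := h hx
      exact ⟨j, ⟨hji, trivial⟩, by tauto⟩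
    refine (card_le_card hsub).trans ((card_biUnion_le_card_mul _ _ (2 * d) fun j hj => ?_).trans
      (Nat.mul_le_mul_right _ ((card_erase_le).trans (by simp))))
    refine (card_union_le _ _).trans ?_
    have h1 := hvd i j (mem_erase.mp hj).1.symm
    have h2 := card_filter_degree_lt G hKtt ht hD (hSi _ (hvI i)) (hSi _ (hvI j))
      (by rwa [hSs _ (hvI j)]) hd
    omega
  have hγ2 : γ ≤ γ ^ 2 := Nat.le_self_pow two_ne_zero γ
  have hedge : ∀ i j, i ≠ j → ∀ A ⊆ T i, ∀ A' ⊆ T j, #(T i \ A) ≤ 2 * γ ^ 2 * d →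
      #(T j \ A') ≤ 2 * γ ^ 2 * d → ∃ a ∈ A, ∃ b ∈ A', G.Adj a b := by
    intro i j hij A hA A' hA' hc hc'
    have hbound : ∀ k, ∀ A ⊆ T k, #(T k \ A) ≤ 2 * γ ^ 2 * d →
        #(S (v k) \ A) ≤ 4 * γ ^ 2 * d := by
      intro k A hA hc
      have hsub : S (v k) \ A ⊆ (S (v k) \ T k) ∪ (T k \ A) := by
        intro x hx
        simp only [mem_union, mem_sdiff] at hx ⊢
        tauto
      have h1 := (card_le_card hsub).trans (card_union_le _ _)
      have h2 := hTloss k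
      nlinarith [Nat.mul_le_mul_right d hγ2]
    refine hB (hvB i) (hvB j) (hv.ne hij) A (hA.trans (hTS i)) A' (hA'.trans (hTS j))
      (hbound i A hA hc) (hbound j A' hA' hc') (disjoint_left.mpr fun x hx hx' => ?_)
    exact hij ((hTv j i x (hA' hx')).mp ((hTv i i x (hA hx)).mpr rfl))
  have : Nonempty V := ⟨v ⟨0, hγ⟩⟩
  obtain ⟨a, b, hab, hind⟩ := exists_induced_matching G T hTi
    (fun i j hij u hu => (card_le_card (filter_subset_filter _ (hTS j))).trans
      ((mem_filter.mp hu).2 j hij.symm).2.le) hedge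
    (univ.filter fun p : Fin γ × Fin γ => p.1 < p.2) (fun p hp => (mem_filter.mp hp).2.ne)
    (Nat.mul_le_mul_right _ (Nat.mul_le_mul_left _ ((card_filter_le _ _).trans (by simp [sq]))))
  simp only [mem_filter, mem_univ, true_and, Prod.forall, ne_eq] at hab hind
  let x : Fin γ → Fin γ → V := fun i j => if i < j then a (i, j) else b (j, i)
  have hxT : ∀ i j, i ≠ j → x i j ∈ T i := by
    intro i j hij
    rcases hij.lt_or_gt with h | h
    · simpa [x, h] using (hab i j h).1
    · simpa [x, h.not_gt] using (hab j i h).2.1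
  refine nonempty_twoSubdivision_top_embedding G v x hv (fun i j => hI _ (hvI i) _ (hvI j))
    (fun i j k hij => hTv i k _ (hxT i j hij)) fun i j k l hij hkl => ⟨fun h => ?_, ?_⟩
  · by_cases hik : i = k
    · subst hik
      exact (hTi i _ (hxT i j hij) _ (hxT i l hkl) h).elim
    · rcases hij.lt_or_gt with h1 | h1 <;> rcases hkl.lt_or_gt with h2 | h2
      · simp only [x, h1, h2, if_true] at h
        exact ((hind i j h1 k l h2 (by simp; tauto)).1 h).elim
      · simp only [x, h1, h2.not_gt, if_true, if_false] at h
        by_contra hne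
        exact (hind i j h1 l k h2 (by simpa using hne)).2.1 h
      · simp only [x, h1.not_gt, h2, if_true, if_false] at h
        by_contra hne
        exact (hind j i h1 k l h2 (by simp; tauto)).2.2.1 h
      · simp only [x, h1.not_gt, h2.not_gt, if_false] at h
        exact ((hind j i h1 l k h2 (by simp; tauto)).2.2.2 h).elim
  · rintro ⟨rfl, rfl⟩
    rcases hij.lt_or_gt with h | h
    · simpa [x, h, h.not_gt] using (hab i j h).2.2
    · simpa [x, h, h.not_gt] using (hab j i h).2.2.symm

/-- The numerical estimates behind `smallAlphaNeighbours`. -/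
theorem smallAlphaNeighbours_bounds {C γ t : ℕ} (hC : 2 ≤ C) (hγ : 2 ≤ γ) (ht : 0 < t) :
    C * (128 * C * t * γ ^ 2) ^ (t + 1) ≤ (512 * C) ^ (γ ^ (2 * t)) ∧
      2 * (128 * C * t * γ ^ 2) * (2 * (2 * C + 1)) ^ γ ≤ (512 * C) ^ (γ ^ (2 * t)) := by
  obtain ⟨E, hE⟩ : ∃ E, E = γ ^ (2 * t) := ⟨_, rfl⟩
  rw [← hE]
  have h4t : 4 ^ t ≤ E := by
    rw [hE, pow_mul]
    exact Nat.pow_le_pow_left (by nlinarith) t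
  have hγE : γ ^ 2 ≤ E := hE ▸ Nat.pow_le_pow_right (by omega) (by omega)
  have ht4 : 2 * t + 2 ≤ 4 ^ t ∧ t * (t + 1) ≤ 2 * 4 ^ t := by
    clear h4t hE
    induction t, ht using Nat.le_induction with
    | base => norm_num
    | succ n hn ih => rw [pow_succ]; constructor <;> nlinarith [ih.1, ih.2]
  have hE2 : E ≤ 2 ^ E := Nat.lt_two_pow_self.le
  have ht2 : t ≤ 2 ^ t := Nat.lt_two_pow_self.le
  have hCpos : 0 < C := by omega
  constructor
  · have e1 : C * C ^ (t + 1) ≤ C ^ E := by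
      rw [← pow_succ']
      exact Nat.pow_le_pow_right hCpos (by omega)
    have e2 : 128 ^ (t + 1) ≤ 2 ^ (4 * E) := by
      rw [show 128 = 2 ^ 7 by norm_num, ← pow_mul]
      exact Nat.pow_le_pow_right two_pos (by omega)
    have e3 : t ^ (t + 1) ≤ 2 ^ (2 * E) := by
      refine (Nat.pow_le_pow_left ht2 _).trans ?_
      rw [← pow_mul]
      exact Nat.pow_le_pow_right two_pos (by omega)
    have e4 : (γ ^ 2) ^ (t + 1) ≤ 2 ^ (2 * E) := by
      rw [pow_succ, ← pow_mul, ← hE, two_mul, pow_add]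
      exact Nat.mul_le_mul hE2 (hγE.trans hE2)
    calc C * (128 * C * t * γ ^ 2) ^ (t + 1)
        = C * C ^ (t + 1) * (128 ^ (t + 1) * t ^ (t + 1) * (γ ^ 2) ^ (t + 1)) := by
          rw [mul_pow, mul_pow, mul_pow]; ring
      _ ≤ C ^ E * (2 ^ (4 * E) * 2 ^ (2 * E) * 2 ^ (2 * E)) := by gcongr
      _ = C ^ E * 2 ^ (8 * E) := by ring
      _ ≤ C ^ E * 2 ^ (9 * E) := by gcongr <;> omega
      _ = (512 * C) ^ E := by rw [mul_pow, pow_mul]; norm_num; ring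
  · have hγ2 : γ + 2 ≤ E := by nlinarith
    have e1 : C * C ^ γ ≤ C ^ E := by
      rw [← pow_succ']
      exact Nat.pow_le_pow_right hCpos (by omega)
    have e2 : 2 * 128 * 8 ^ γ ≤ 2 ^ (5 * E) := by
      rw [show 2 * 128 = 2 ^ 8 by norm_num, show 8 = 2 ^ 3 by norm_num, ← pow_mul, ← pow_add]
      exact Nat.pow_le_pow_right two_pos (by omega)
    have e3 : t ≤ 2 ^ E := by omega
    calc 2 * (128 * C * t * γ ^ 2) * (2 * (2 * C + 1)) ^ γ
        ≤ 2 * (128 * C * t * γ ^ 2) * (8 * C) ^ γ :=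
          Nat.mul_le_mul_left _ (Nat.pow_le_pow_left (by omega) γ)
      _ = C * C ^ γ * (2 * 128 * 8 ^ γ * t * γ ^ 2) := by rw [mul_pow]; ring
      _ ≤ C ^ E * (2 ^ (5 * E) * 2 ^ E * 2 ^ E) := by
          have e4 := hγE.trans hE2
          gcongr
      _ = C ^ E * 2 ^ (7 * E) := by ring
      _ ≤ C ^ E * 2 ^ (9 * E) := by gcongr <;> omega
      _ = (512 * C) ^ E := by rw [mul_pow, pow_mul]; norm_num; ring

/-- Lemma of Chudnovsky, Codsi, Lokshtanov, Milanič and Sintiari: in a graph with no induced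
2-subdivision of `K_γ` and no induced `K_{t,t}`, for any set `Y` the set `Z` of vertices whose
closed neighbourhood meets `Y` in an independence number at least `α(Y)/C` satisfies
`min {α(Y), α(Z)} ≤ (512 C) ^ (γ ^ (2 t))`. -/
theorem smallAlphaNeighbours (C γ t : ℕ) (hC : 2 ≤ C) (hγ : 2 ≤ γ)
    {V : Type} [Fintype V] (G : SimpleGraph V)
    (hKγ : IsEmpty (twoSubdivision (⊤ : SimpleGraph (Fin γ)) ↪g G))
    (hKtt : IsEmpty (completeBipartiteGraph (Fin t) (Fin t) ↪g G))
    (Y : Set V) :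
    min (indepNumOn G Y)
        (indepNumOn G {v : V |
          (indepNumOn G Y : ℝ) / (C : ℝ) ≤
            (indepNumOn G ((insert v (G.neighborSet v)) ∩ Y) : ℝ)}) ≤
      (512 * C) ^ (γ ^ (2 * t)) := by
  by_contra! hcon
  obtain ⟨hαY, hαZ⟩ := lt_min_iff.mp hcon
  have ht : 0 < t := by
    rcases Nat.eq_zero_or_pos t with rfl | ht
    · obtain ⟨φ⟩ := nonempty_completeBipartiteGraph_embedding G (A := ∅) (X := ∅)
        rfl rfl (by simp) (by simp) (by simp)
      exact (hKtt.false φ).elim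
    · exact ht
  obtain ⟨hs_bound, hI_bound⟩ := smallAlphaNeighbours_bounds hC hγ ht
  set q := 32 * C * γ ^ 2 with hq
  have hD : 128 * C * t * γ ^ 2 = 4 * t * q := by rw [hq]; ring
  rw [hD] at hs_bound hI_bound
  set D := 4 * t * q with hD'
  have hqpos : 0 < q := by positivity
  have hDpos : 0 < D := by positivity
  set s := ⌈(indepNumOn G Y : ℝ) / (C : ℝ)⌉₊ with hs
  have hαs : indepNumOn G Y ≤ C * s := by
    have h := Nat.le_ceil ((indepNumOn G Y : ℝ) / (C : ℝ))
    rw [div_le_iff₀ (by positivity)] at h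
    rw [mul_comm]
    exact_mod_cast h
  have hsD : D ^ (t + 1) ≤ s :=
    Nat.le_of_mul_le_mul_left (hs_bound.trans (hαY.le.trans hαs)) (by omega)
  have hDs : 2 ≤ s := by
    have h1 : D ^ 1 ≤ D ^ (t + 1) := Nat.pow_le_pow_right hDpos (by omega)
    nlinarith
  have hdq : q * (s / q) ≤ s := Nat.mul_div_le s q
  have hd : 2 * t * D ^ t ≤ s / q := by
    rw [Nat.le_div_iff_mul_le hqpos]
    refine le_trans ?_ hsD
    rw [pow_succ]
    nlinarith [Nat.zero_le (D ^ t * (t * q))]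
  have hDd : 2 * t * s ≤ D * (s / q) := by
    have h1 : s < q * (s / q + 1) := Nat.lt_mul_div_succ s hqpos
    have h2 : 1 ≤ s / q := le_trans (Nat.succ_le_of_lt (by positivity)) hd
    have h3 : s ≤ 2 * (q * (s / q)) := by nlinarith
    calc 2 * t * s ≤ 2 * t * (2 * (q * (s / q))) := Nat.mul_le_mul_left _ h3
      _ = D * (s / q) := by rw [hD']; ring
  obtain ⟨I, hIcard, hIZ, hI⟩ := exists_independent_of_le_indepNumOn G hαZ.le
  have hS : ∀ v ∈ I, ∃ S : Finset V, S.card = s ∧ (∀ u ∈ S, u ∈ insert v (G.neighborSet v) ∩ Y) ∧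
      ∀ u ∈ S, ∀ w ∈ S, ¬ G.Adj u w := fun v hv =>
    exists_independent_of_le_indepNumOn G (Nat.ceil_le.mpr (hIZ v hv))
  choose! S hSs hSN hSi using hS
  have hSadj : ∀ v ∈ I, ∀ u ∈ S v, G.Adj v u := by
    intro v hv u hu
    rcases (hSN v hv u hu).1 with rfl | h
    · obtain ⟨w, hw, hwu⟩ := Finset.exists_mem_ne (by rw [hSs u hv]; omega) u
      rcases (hSN u hv w hw).1 with rfl | h
      · exact (hwu rfl).elim
      · exact (hSi u hv u hu w hw h).elim
    · exact h
  obtain ⟨φ⟩ := nonempty_twoSubdivision_embedding_of_large G (by omega) ht hDpos hKtt S I hI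
    (fun v hv u hu => (hSN v hv u hu).2) hSi hSs hSadj (by omega) hαs hDd hd hdq
    (hI_bound.trans hIcard.ge)
  exact hKγ.false φ
end

section
/- For every k ∈ ℕ, the 2-subdivision of the complete graph on 2k + 2 vertices, K_{2k+2}^{(2)}, does not admit (k, 1)-balanced separators. That is, there exists a vertex-weight function μ on K_{2k+2}^{(2)} (namely, the indicator function of the set of branch vertices, i.e. the 2k + 2 original high-degree vertices) such that no (k, 1)-centred set of K_{2k+2}^{(2)} is a balanced separator for μ. -/
open SimpleGraph
open scoped ENNReal NNReal

/-- The vertex type of the 2-subdivision of the complete graph on `Fin n`. -/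
abbrev SubKVert (n : ℕ) : Type :=
  Fin n ⊕ {p : Fin n × Fin n // (⊤ : SimpleGraph (Fin n)).Adj p.1 p.2}

/-- The 2-subdivision of the complete graph on `n` vertices. -/
def subK (n : ℕ) : SimpleGraph (SubKVert n) :=
  twoSubdivision (⊤ : SimpleGraph (Fin n))

/-- The branch (original, high-degree) vertices of the 2-subdivision of `K_n`. -/
def branchSet (n : ℕ) : Set (SubKVert n) := Set.range Sum.inl

/-- The branch vertex nearest to a given vertex of the 2-subdivision of `K_n`. -/
def nearestBranch {n : ℕ} : SubKVert n → Fin n :=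
  Sum.elim id fun p => p.1.1

theorem subK_adj_branch {n : ℕ}
    (p : {p : Fin n × Fin n // (⊤ : SimpleGraph (Fin n)).Adj p.1 p.2}) :
    (subK n).Adj (Sum.inl p.1.1) (Sum.inr p) := by
  simp [subK, twoSubdivision]

theorem subK_adj_swap {n : ℕ} {x y : Fin n} (h : (⊤ : SimpleGraph (Fin n)).Adj x y) :
    (subK n).Adj (Sum.inr ⟨(x, y), h⟩) (Sum.inr ⟨(y, x), h.symm⟩) := by
  have h' : x ≠ y := h
  simp [subK, twoSubdivision, h']

theorem nearestBranch_eq_of_adj_inl {n : ℕ} {t : SubKVert n} {x : Fin n}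
    (h : (subK n).Adj t (Sum.inl x)) : nearestBranch t = x := by
  rcases t with t | t <;> simp_all [subK, twoSubdivision, nearestBranch]

theorem nearestBranch_eq_or_eq_of_adj_inr {n : ℕ} {t : SubKVert n}
    {p : {p : Fin n × Fin n // (⊤ : SimpleGraph (Fin n)).Adj p.1 p.2}}
    (h : (subK n).Adj t (Sum.inr p)) : nearestBranch t = p.1.1 ∨ nearestBranch t = p.1.2 := by
  rcases t with t | t
  · simp_all [subK, twoSubdivision, nearestBranch]
  · simp only [subK, twoSubdivision, nearestBranch, fromRel_adj] at h ⊢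
    rcases h.2 with h | h
    · exact Or.inr h.1
    · exact Or.inr h.2.symm

theorem mem_ballAround_one {V : Type*} {G : SimpleGraph V} {T : Set V} {v : V} :
    v ∈ ballAround G T 1 ↔ ∃ t ∈ T, G.Adj t v ∨ t = v := by
  simp [ballAround, edist_le_one_iff_adj_or_eq]

theorem inl_notMem_ballAround {n : ℕ} {T : Set (SubKVert n)} {x : Fin n}
    (hx : x ∉ nearestBranch '' T) : Sum.inl x ∉ ballAround (subK n) T 1 := by
  rw [mem_ballAround_one]
  rintro ⟨t, ht, h | rfl⟩
  · exact hx ⟨t, ht, nearestBranch_eq_of_adj_inl h⟩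
  · exact hx ⟨_, ht, rfl⟩

theorem inr_notMem_ballAround {n : ℕ} {T : Set (SubKVert n)}
    {p : {p : Fin n × Fin n // (⊤ : SimpleGraph (Fin n)).Adj p.1 p.2}}
    (h₁ : p.1.1 ∉ nearestBranch '' T) (h₂ : p.1.2 ∉ nearestBranch '' T) :
    Sum.inr p ∉ ballAround (subK n) T 1 := by
  rw [mem_ballAround_one]
  rintro ⟨t, ht, h | rfl⟩
  · rcases nearestBranch_eq_or_eq_of_adj_inr h with h | h
    · exact h₁ ⟨t, ht, h⟩
    · exact h₂ ⟨t, ht, h⟩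
  · exact h₁ ⟨_, ht, rfl⟩

/-- Branch vertices that are not nearest to any vertex of `T` stay connected after deleting a set
contained in the radius-1 ball around `T`. -/
theorem subK_induce_compl_reachable {n : ℕ} {S T : Set (SubKVert n)}
    (hS : S ⊆ ballAround (subK n) T 1) {x y : Fin n}
    (hx : x ∉ nearestBranch '' T) (hy : y ∉ nearestBranch '' T) :
    ((subK n).induce Sᶜ).Reachable
      ⟨Sum.inl x, fun h => inl_notMem_ballAround hx (hS h)⟩
      ⟨Sum.inl y, fun h => inl_notMem_ballAround hy (hS h)⟩ := by
  by_cases hxy : x = y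
  · subst hxy
    rfl
  have hadj : (⊤ : SimpleGraph (Fin n)).Adj x y := hxy
  let a : ↥Sᶜ := ⟨Sum.inr ⟨(x, y), hadj⟩, fun h => inr_notMem_ballAround hx hy (hS h)⟩
  let b : ↥Sᶜ := ⟨Sum.inr ⟨(y, x), hadj.symm⟩, fun h => inr_notMem_ballAround hy hx (hS h)⟩
  have h₁ : ((subK n).induce Sᶜ).Adj ⟨Sum.inl x, fun h => inl_notMem_ballAround hx (hS h)⟩ a :=
    subK_adj_branch ⟨(x, y), hadj⟩
  have h₂ : ((subK n).induce Sᶜ).Adj a b := subK_adj_swap hadj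
  have h₃ : ((subK n).induce Sᶜ).Adj ⟨Sum.inl y, fun h => inl_notMem_ballAround hy (hS h)⟩ b :=
    subK_adj_branch ⟨(y, x), hadj.symm⟩
  exact h₁.reachable.trans (h₂.reachable.trans h₃.symm.reachable)

theorem not_isBalancedSeparator_of_isCentred (k : ℕ) {S : Set (SubKVert (2 * k + 2))}
    (hS : IsCentred (subK (2 * k + 2)) k 1 S) :
    ¬ IsBalancedSeparator (subK (2 * k + 2)) (Sum.elim (fun _ => 1) fun _ => 0) S := by
  classical
  obtain ⟨T, hT, hST⟩ := hS
  set A : Set (Fin (2 * k + 2)) := nearestBranch '' T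
  have hAcard : A.ncard ≤ k := (Set.ncard_image_le T.toFinite).trans hT
  have hAc : k + 2 ≤ Fintype.card ↥Aᶜ := by
    have h := Set.ncard_add_ncard_compl A
    rw [Nat.card_eq_fintype_card, Fintype.card_fin] at h
    rw [← Nat.card_eq_fintype_card, Nat.card_coe_set_eq]
    omega
  have hmem (x : ↥Aᶜ) : Sum.inl x.1 ∈ Sᶜ := fun h => inl_notMem_ballAround x.2 (hST h)
  let e : ↥Aᶜ ↪ ↥Sᶜ :=
    ⟨fun x => ⟨Sum.inl x.1, hmem x⟩, fun x y h =>
      Subtype.ext (Sum.inl_injective (congrArg Subtype.val h))⟩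
  obtain ⟨x₀⟩ : Nonempty ↥Aᶜ := Fintype.card_pos_iff.mp (by omega)
  intro h
  have hC := h (((subK (2 * k + 2)).induce Sᶜ).connectedComponentMk (e x₀))
  rw [finsum_mem_eq_toFinset_sum, finsum_eq_sum_of_fintype, Fintype.sum_sum_type] at hC
  have hle := Finset.sum_le_sum_of_subset
    (f := fun v : ↥Sᶜ => (Sum.elim (fun _ => 1) (fun _ => 0) v.1 : NNReal))
    (show Finset.univ.map e ⊆
      (((subK (2 * k + 2)).induce Sᶜ).connectedComponentMk (e x₀)).supp.toFinset by
      intro v hv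
      obtain ⟨x, -, rfl⟩ := Finset.mem_map.mp hv
      rw [Set.mem_toFinset, ConnectedComponent.mem_supp_iff, ConnectedComponent.eq]
      exact subK_induce_compl_reachable hST x.2 x₀.2)
  have hbound := hle.trans hC
  have hsum : ∑ v ∈ Finset.univ.map e,
      (Sum.elim (fun _ => 1) (fun _ => 0) v.1 : NNReal) = Fintype.card ↥Aᶜ := by
    rw [Finset.sum_map]
    change ∑ _x : ↥Aᶜ, (1 : NNReal) = _
    simp
  rw [hsum] at hbound
  simp only [Sum.elim_inl, Sum.elim_inr, Finset.sum_const, Finset.card_univ, nsmul_eq_mul,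
    mul_one, Fintype.card_fin, mul_zero, add_zero] at hbound
  have hAc' : ((k + 2 : ℕ) : NNReal) ≤ (Fintype.card ↥Aᶜ : NNReal) := Nat.cast_le.mpr hAc
  have hfinal := hAc'.trans hbound
  rw [← NNReal.coe_le_coe] at hfinal
  push_cast at hfinal
  linarith

/-- The 2-subdivision of `K_{2k+2}` does not admit `(k, 1)`-balanced separators; indeed, for
the indicator weight function of the branch vertices, no `(k, 1)`-centred set is a balanced
separator. -/
theorem subK_not_admitsBalancedSeparators (k : ℕ) :
    ¬ AdmitsBalancedSeparators (subK (2 * k + 2)) k 1 ∧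
    ∀ S : Set (SubKVert (2 * k + 2)),
      IsCentred (subK (2 * k + 2)) k 1 S →
      ¬ IsBalancedSeparator (subK (2 * k + 2))
          (fun v => match v with | Sum.inl _ => 1 | Sum.inr _ => 0) S := by
  have hmain (S : Set (SubKVert (2 * k + 2))) (hS : IsCentred (subK (2 * k + 2)) k 1 S)
      (μ : SubKVert (2 * k + 2) → NNReal) (hμ : μ = Sum.elim (fun _ => 1) fun _ => 0) :
      ¬ IsBalancedSeparator (subK (2 * k + 2)) μ S :=
    hμ ▸ not_isBalancedSeparator_of_isCentred k hS
  refine ⟨fun h => ?_, fun S hS => hmain S hS _ (by ext (_ | _) <;> rfl)⟩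
  obtain ⟨S, hS, hbal⟩ := h (Sum.elim (fun _ => 1) fun _ => 0)
  exact hmain S hS _ rfl hbal
end
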